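/- arXiv:1311.1479 — 2 statements merged into one kernel-verified Lean document; each statement's English description precedes it below -/
import Mathlib

section
/- Over a field of characteristic 0, a reduced irreducible plane curve all of whose smooth points are inflection points is a line. -/
open MvPolynomial

/-- Chain rule for a derivation applied to a polynomial expression. -/
theorem Derivation.apply_mvPolynomial_aeval {R A M σ : Type*} [CommRing R] [CommRing A]
    [Algebra R A] [AddCommGroup M] [Module A M] [Module R M] [IsScalarTower R A M] [Fintype σ]
    (D : Derivation R A M) (f : σ → A) (p : MvPolynomial σ R) :
    D (aeval f p) = ∑ i, aeval f (pderiv i p) • D (f i) := by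
  classical
  induction p using MvPolynomial.induction_on with
  | C a => simp [MvPolynomial.algHom_C]
  | add p q hp hq => simp [hp, hq, add_smul, Finset.sum_add_distrib]
  | mul_X p j hp =>
    simp [hp, pderiv_X, Pi.single_apply, add_smul, Finset.sum_add_distrib, Finset.smul_sum,
      mul_smul, apply_ite, ite_smul]

theorem MvPolynomial.pderiv_comm {R σ : Type*} [CommRing R] (i j : σ) (p : MvPolynomial σ R) :
    pderiv i (pderiv j p) = pderiv j (pderiv i p) := by
  classical
  have h : ⁅pderiv (R := R) i, pderiv (R := R) j⁆ = 0 := by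
    refine MvPolynomial.derivation_ext fun l => ?_
    simp [Derivation.commutator_apply, pderiv_X, Pi.single_apply, apply_ite]
  have := congrArg (fun D : Derivation R (MvPolynomial σ R) (MvPolynomial σ R) => D p) h
  simpa [Derivation.commutator_apply, sub_eq_zero] using this

section

attribute [local instance] FractionRing.liftAlgebra

/-- In a finitely generated field extension of a field of characteristic zero, an element with
vanishing differential is algebraic. -/
theorem isAlgebraic_of_kaehlerDifferential_D_eq_zero {k K : Type*} [Field k] [CharZero k]
    [Field K] [Algebra k K] [Algebra.EssFiniteType k K] {r : K}
    (hr : KaehlerDifferential.D k K r = 0) : IsAlgebraic k r := by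
  by_contra htr
  let : Algebra (Polynomial k) K := (Polynomial.aeval r).toRingHom.toAlgebra
  have hX : algebraMap (Polynomial k) K Polynomial.X = r := Polynomial.aeval_X r
  have : IsScalarTower k (Polynomial k) K :=
    .of_algebraMap_eq fun x => (Polynomial.aeval_C r x).symm
  have : FaithfulSMul (Polynomial k) K := by
    rw [faithfulSMul_iff_algebraMap_injective]
    exact transcendental_iff_injective.mp htr
  let L := FractionRing (Polynomial k)
  have : CharZero L := charZero_of_injective_algebraMap (algebraMap k L).injective
  have : IsScalarTower k L K := .of_algebraMap_eq fun x => by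
    rw [IsScalarTower.algebraMap_apply k (Polynomial k) K,
      IsScalarTower.algebraMap_apply (Polynomial k) L K,
      ← IsScalarTower.algebraMap_apply k (Polynomial k) L]
  have : Algebra.EssFiniteType L K := .of_comp k L K
  have : Algebra.FormallyEtale (Polynomial k) L :=
    .of_isLocalization (nonZeroDivisors (Polynomial k))
  have : Algebra.FormallySmooth (Polynomial k) K := .comp (Polynomial k) L K
  have hinj : Function.Injective (KaehlerDifferential.mapBaseChange k (Polynomial k) K) := by
    rw [injective_iff_map_eq_zero]
    intro x hx
    obtain ⟨y, rfl⟩ := (Algebra.H1Cotangent.exact_δ_mapBaseChange k (Polynomial k) K x).mp hx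
    rw [Subsingleton.elim y 0, map_zero]
  have h0 : (1 : K) ⊗ₜ[Polynomial k] KaehlerDifferential.D k (Polynomial k) Polynomial.X = 0 := by
    apply hinj
    rw [KaehlerDifferential.mapBaseChange_tmul, KaehlerDifferential.map_D, hX, hr]
    simp
  have h1 := congrArg ((TensorProduct.rid (Polynomial k) K) ∘
    ((KaehlerDifferential.polynomialEquiv k).toLinearMap.lTensor K)) h0
  simp [KaehlerDifferential.polynomialEquiv_D] at h1

end

/-- Polarization on a hyperplane: a symmetric form vanishing on the hyperplane orthogonal to `g`
pairs the vectors `g j • e i - g i • e j` to zero. -/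
theorem polarization_of_forall_orthogonal {k ι : Type*} [Field k] [CharZero k] [Fintype ι]
    (g : ι → k) (H : ι → ι → k) (hH : ∀ i l, H i l = H l i)
    (h : ∀ w : ι → k, ∑ i, w i * g i = 0 → ∑ i, w i * ∑ l, w l * H l i = 0) (i j l : ι) :
    g j ^ 2 * H i l - g j * g i * H j l - g j * g l * H i j + g i * g l * H j j = 0 := by
  classical
  have key : ∀ a b c : k, a * g i + b * g l + c * g j = 0 →
      a ^ 2 * H i i + b ^ 2 * H l l + c ^ 2 * H j j + 2 * a * b * H i l + 2 * a * c * H i j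
        + 2 * b * c * H j l = 0 := by
    intro a b c habc
    have := h (fun m => a * Pi.single (M := fun _ => k) i 1 m + b * Pi.single (M := fun _ => k) l 1 m
      + c * Pi.single (M := fun _ => k) j 1 m)
      (by simpa [add_mul, Finset.sum_add_distrib, Pi.single_apply] using habc)
    simp only [add_mul, Finset.sum_add_distrib, Pi.single_apply, mul_ite, mul_one, mul_zero,
      ite_mul, zero_mul, Finset.sum_ite_eq', Finset.mem_univ, if_true] at this
    rw [hH l i, hH j i, hH l j] at this
    linear_combination this
  have h1 := key (g j) (g j) (-(g i + g l)) (by ring)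
  have h2 := key (g j) 0 (-g i) (by ring)
  have h3 := key 0 (g j) (-g l) (by ring)
  have h4 : (2 : k) * (g j ^ 2 * H i l - g j * g i * H j l - g j * g l * H i j
      + g i * g l * H j j) = 0 := by
    linear_combination h1 - h2 - h3
  exact (mul_eq_zero.mp h4).resolve_left two_ne_zero

/-- If a polynomial vanishes to order at least three along a line, its second derivative in the
direction of the line vanishes. -/
theorem sum_mul_pderiv_pderiv_eq_zero {k σ : Type*} [Field k] [Fintype σ]
    (F : MvPolynomial σ k) (v w : σ → k)
    (h : aeval (fun i => Polynomial.C (v i) + Polynomial.X * Polynomial.C (w i)) F = 0 ∨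
        3 ≤ Polynomial.rootMultiplicity 0
          (aeval (fun i => Polynomial.C (v i) + Polynomial.X * Polynomial.C (w i)) F)) :
    ∑ i, w i * ∑ l, w l * eval v (pderiv l (pderiv i F)) = 0 := by
  set f : σ → Polynomial k := fun i => Polynomial.C (v i) + Polynomial.X * Polynomial.C (w i)
    with hf
  have hder : ∀ p : MvPolynomial σ k, Polynomial.derivative (aeval f p)
      = ∑ i, aeval f (pderiv i p) * Polynomial.C (w i) := by
    intro p
    have := Derivation.apply_mvPolynomial_aeval (Polynomial.derivative' (R := k)) f p
    simpa [hf] using this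
  have heval : ∀ p : MvPolynomial σ k, (aeval f p).eval 0 = eval v p := by
    intro p
    have := MvPolynomial.comp_aeval_apply (f := f) (Polynomial.aeval (R := k) (0 : k)) p
    simp only [hf, Polynomial.coe_aeval_eq_eval, Polynomial.eval_add, Polynomial.eval_C,
      Polynomial.eval_mul, Polynomial.eval_X, zero_mul, add_zero] at this
    rw [this, MvPolynomial.aeval_eq_eval]
  have hdvd : Polynomial.X ^ 3 ∣ aeval f F := by
    rcases h with h | h
    · simp [h]
    · have := (Polynomial.pow_rootMultiplicity_dvd (aeval f F) 0)
      rw [Polynomial.C_0, sub_zero] at this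
      exact (pow_dvd_pow _ h).trans this
  obtain ⟨q, hq⟩ := hdvd
  have h2 : (Polynomial.derivative (Polynomial.derivative (aeval f F))).eval 0 = 0 := by
    rw [hq]
    simp [Polynomial.derivative_mul]
  rw [hder, Polynomial.derivative_sum] at h2
  simp only [Polynomial.derivative_mul, hder, Polynomial.derivative_C, mul_zero, add_zero,
    Polynomial.eval_finsetSum, Polynomial.eval_mul, Polynomial.eval_C, heval] at h2
  rw [← h2]
  exact Finset.sum_congr rfl fun i _ => by
    rw [mul_comm]
    exact congrArg (· * w i) (Finset.sum_congr rfl fun l _ => mul_comm _ _)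

/-- If the second fundamental form of the hypersurface `F = 0` vanishes at its generic point, then
the ratios of the partial derivatives have zero differential. -/
theorem Derivation.map_div_pderiv_eq_zero {k K M σ : Type*} [Field k] [Field K] [Algebra k K]
    [AddCommGroup M] [Module K M] [Module k M] [IsScalarTower k K M] [Fintype σ]
    (D : Derivation k K M) (x : σ → K) (F : MvPolynomial σ k) (hF : aeval x F = 0) (j l : σ)
    (hj : aeval x (pderiv j F) ≠ 0)
    (h : ∀ i, aeval x (pderiv j F ^ 2 * pderiv i (pderiv l F)
      - pderiv j F * pderiv i F * pderiv j (pderiv l F)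
      - pderiv j F * pderiv l F * pderiv i (pderiv j F)
      + pderiv i F * pderiv l F * pderiv j (pderiv j F)) = 0) :
    D (aeval x (pderiv l F) / aeval x (pderiv j F)) = 0 := by
  set g : σ → K := fun i => aeval x (pderiv i F)
  have hsum : ∑ i, g i • D (x i) = 0 := by
    rw [← Derivation.apply_mvPolynomial_aeval, hF, map_zero]
  have hmain : g j • (g j • D (g l) - g l • D (g j)) = 0 := by
    rw [Derivation.apply_mvPolynomial_aeval, Derivation.apply_mvPolynomial_aeval,
      Finset.smul_sum, Finset.smul_sum, ← Finset.sum_sub_distrib, Finset.smul_sum]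
    calc _ = ∑ i, (g j * aeval x (pderiv j (pderiv l F)) - g l * aeval x (pderiv j (pderiv j F)))
            • g i • D (x i) := by
          refine Finset.sum_congr rfl fun i _ => ?_
          have hi := h i
          simp only [map_add, map_sub, map_mul, map_pow] at hi
          simp only [smul_smul, ← sub_smul]
          congr 1
          linear_combination hi
      _ = 0 := by rw [← Finset.smul_sum, hsum, smul_zero]
  have h1 : g j • D (g l) - g l • D (g j) = 0 := (smul_eq_zero.mp hmain).resolve_left hj
  have h2 : D (g l) = (g l / g j) • D (g j) + g j • D (g l / g j) := by
    rw [← Derivation.leibniz, div_mul_cancel₀ _ hj]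
  rw [h2, smul_add, smul_smul, mul_div_cancel₀ _ hj, add_sub_cancel_left, smul_smul] at h1
  exact (smul_eq_zero.mp h1).resolve_left (mul_ne_zero hj hj)

/-- A nonzero multiple of `F` cannot be homogeneous of smaller degree. -/
theorem MvPolynomial.IsHomogeneous.eq_zero_of_dvd {k σ : Type*} [Field k]
    {F p : MvPolynomial σ k} {d : ℕ} (hF : F.IsHomogeneous d) (hF0 : F ≠ 0)
    (hp : p.IsHomogeneous (d - 1)) (hd : d ≠ 0) (h : F ∣ p) : p = 0 := by
  by_contra hp0
  have := totalDegree_le_of_dvd_of_isDomain h hp0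
  rw [hF.totalDegree hF0, hp.totalDegree hp0] at this
  omega

/-- If the second fundamental form of an irreducible homogeneous `F` vanishes modulo `F`, then
the partial derivatives of `F` are proportional. -/
theorem exists_pderiv_eq_C_mul {k σ : Type*} [Field k] [IsAlgClosed k] [CharZero k] [Finite σ]
    {F : MvPolynomial σ k} {d : ℕ} (hF : F.IsHomogeneous d) (hd : d ≠ 0) (hirr : Irreducible F)
    {j : σ} (hj : pderiv j F ≠ 0)
    (h : ∀ i l, F ∣ pderiv j F ^ 2 * pderiv i (pderiv l F)
      - pderiv j F * pderiv i F * pderiv j (pderiv l F)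
      - pderiv j F * pderiv l F * pderiv i (pderiv j F)
      + pderiv i F * pderiv l F * pderiv j (pderiv j F)) (l : σ) :
    ∃ c : k, pderiv l F = C c * pderiv j F := by
  have := Fintype.ofFinite σ
  have hprime : (Ideal.span {F}).IsPrime :=
    (Ideal.span_singleton_prime hirr.ne_zero).mpr hirr.prime
  let A := MvPolynomial σ k ⧸ Ideal.span {F}
  let K := FractionRing A
  have : Algebra.EssFiniteType A K := .of_isLocalization K (nonZeroDivisors A)
  have : Algebra.EssFiniteType k K := .comp k A K
  let x : σ → K := fun i => algebraMap A K (Ideal.Quotient.mk _ (X i))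
  have hx : ∀ p : MvPolynomial σ k, aeval x p = algebraMap A K (Ideal.Quotient.mk _ p) := by
    intro p
    have : aeval x = (IsScalarTower.toAlgHom k A K).comp (Ideal.Quotient.mkₐ k (Ideal.span {F})) := by
      ext i
      simp only [aeval_X]
      rfl
    rw [this]
    rfl
  have hx0 : ∀ p : MvPolynomial σ k, aeval x p = 0 ↔ F ∣ p := by
    intro p
    rw [hx, map_eq_zero_iff _ (IsFractionRing.injective A K), Ideal.Quotient.eq_zero_iff_dvd]
  have hgj : aeval x (pderiv j F) ≠ 0 := fun h0 =>
    hj (hF.eq_zero_of_dvd hirr.ne_zero hF.pderiv hd ((hx0 _).mp h0))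
  have hD := Derivation.map_div_pderiv_eq_zero (KaehlerDifferential.D k K) x F
    ((hx0 F).mpr dvd_rfl) j l hgj (fun i => (hx0 _).mpr (h i l))
  have halg := isAlgebraic_of_kaehlerDifferential_D_eq_zero hD
  obtain ⟨c, hc⟩ := minpoly.mem_range_of_degree_eq_one k _
    (IsAlgClosed.degree_eq_one_of_irreducible k (minpoly.irreducible halg.isIntegral))
  refine ⟨c, sub_eq_zero.mp (hF.eq_zero_of_dvd hirr.ne_zero ?_ hd ?_)⟩
  · exact hF.pderiv.sub (by simpa using (isHomogeneous_C σ c).mul hF.pderiv)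
  · rw [← hx0, map_sub, map_mul, sub_eq_zero, MvPolynomial.aeval_C, hc, div_mul_cancel₀ _ hgj]

/-- In characteristic 0, an irreducible plane curve all of whose smooth points are
inflection points is a line: if `F` is an irreducible homogeneous polynomial of degree
`d` over an algebraically closed field `k` of characteristic 0 such that at every
smooth point the tangent line meets the curve with multiplicity at least 3, then
`d = 1`. -/
theorem flexy_char_zero_is_line (k : Type*) [Field k] [IsAlgClosed k] [CharZero k]
    (F : MvPolynomial (Fin 3) k) (d : ℕ) (hd : F.IsHomogeneous d)
    (hirr : Irreducible F)
    (hflexy : ∀ v w : Fin 3 → k,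
      eval v F = 0 →
      (∃ i, eval v (pderiv i F) ≠ 0) →
      w ≠ 0 →
      (∑ i, w i * eval v (pderiv i F)) = 0 →
      (aeval (fun i => Polynomial.C (v i) + Polynomial.X * Polynomial.C (w i)) F = 0) ∨
        3 ≤ Polynomial.rootMultiplicity 0
          (aeval (fun i => Polynomial.C (v i) + Polynomial.X * Polynomial.C (w i)) F)) :
    d = 1 := by
  have hd0 : d ≠ 0 := by
    rintro rfl
    have hC := totalDegree_eq_zero_iff_eq_C.mp (hd.totalDegree hirr.ne_zero)
    refine hirr.not_isUnit ?_
    have h0 : coeff 0 F ≠ 0 := fun h0 => hirr.ne_zero (by rw [hC, h0, C_0])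
    rw [hC]
    exact (isUnit_iff_ne_zero.mpr h0).map C
  have heuler := hd.sum_X_mul_pderiv
  have hdF : d • F ≠ 0 := smul_ne_zero hd0 hirr.ne_zero
  obtain ⟨j, hj⟩ : ∃ j, pderiv j F ≠ 0 := by
    by_contra! hall
    exact hdF (by rw [← heuler]; simp [hall])
  have hprime : (Ideal.span {F}).IsPrime :=
    (Ideal.span_singleton_prime hirr.ne_zero).mpr hirr.prime
  have hdvd : ∀ i l, F ∣ pderiv j F ^ 2 * pderiv i (pderiv l F)
      - pderiv j F * pderiv i F * pderiv j (pderiv l F)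
      - pderiv j F * pderiv l F * pderiv i (pderiv j F)
      + pderiv i F * pderiv l F * pderiv j (pderiv j F) := by
    intro i l
    rw [← Ideal.mem_span_singleton,
      ← MvPolynomial.IsPrime.vanishingIdeal_zeroLocus (K := k) (Ideal.span {F}),
      mem_vanishingIdeal_iff]
    intro v hv
    have hFv : eval v F = 0 := by
      simpa [aeval_eq_eval] using hv F (Ideal.mem_span_singleton_self F)
    rw [aeval_eq_eval]
    simp only [map_add, map_sub, map_mul, map_pow]
    by_cases hsm : ∃ i, eval v (pderiv i F) ≠ 0
    · refine polarization_of_forall_orthogonal (fun i => eval v (pderiv i F))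
        (fun i l => eval v (pderiv i (pderiv l F))) (fun i l => by rw [pderiv_comm]) ?_ i j l
      intro w hw
      by_cases hw0 : w = 0
      · simp [hw0]
      · exact sum_mul_pderiv_pderiv_eq_zero F v w (hflexy v w hFv hsm hw0 hw)
    · push Not at hsm
      simp [hsm]
  choose c hc using exists_pderiv_eq_C_mul hd hd0 hirr hj hdvd
  have hfac : (∑ i, X i * C (c i)) * pderiv j F = d • F := by
    rw [← heuler, Finset.sum_mul]
    exact Finset.sum_congr rfl fun i _ => by rw [hc i, mul_assoc]
  have hlin : (∑ i, X i * C (c i)).IsHomogeneous 1 :=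
    .sum _ _ _ fun i _ => by simpa using (isHomogeneous_X k i).mul (isHomogeneous_C _ (c i))
  have hlin0 : (∑ i, X i * C (c i)) ≠ 0 := by
    intro h0
    rw [h0, zero_mul] at hfac
    exact hdF hfac.symm
  have hFdvd : F ∣ (∑ i, X i * C (c i)) * pderiv j F := hfac ▸ ⟨d, by rw [nsmul_eq_mul, mul_comm]⟩
  rcases hirr.prime.dvd_or_dvd hFdvd with h | h
  · have := totalDegree_le_of_dvd_of_isDomain h hlin0
    rw [hd.totalDegree hirr.ne_zero, hlin.totalDegree hlin0] at this
    omega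
  · exact absurd (hd.eq_zero_of_dvd hirr.ne_zero hd.pderiv hd0 h) hj
end

section
/- Guth–Katz incidence bound over F_p: there exists an absolute constant c > 0 such that for every prime p, if L is a set of p^2 lines in F_p^3 with no more than p of them lying in any single plane, then the union of the lines in L has cardinality at least c·p^3. -/
section LineRestriction

variable {K : Type*} [Field K]

/-- The restriction of a polynomial in three variables to the line `t ↦ x + t • u`. -/
noncomputable def lineRestrict (x u : Fin 3 → K) : MvPolynomial (Fin 3) K →ₐ[K] Polynomial K :=
  MvPolynomial.aeval fun i => Polynomial.C (x i) + Polynomial.C (u i) * Polynomial.X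

theorem eval_lineRestrict (x u : Fin 3 → K) (F : MvPolynomial (Fin 3) K) (t : K) :
    (lineRestrict x u F).eval t = MvPolynomial.eval (x + t • u) F := by
  induction F using MvPolynomial.induction_on with
  | C a => simp [lineRestrict]
  | add p q hp hq => simp [hp, hq]
  | mul_X p i hp => simp [hp]; left; simp [lineRestrict]; ring

theorem natDegree_lineRestrict_le (x u : Fin 3 → K) (F : MvPolynomial (Fin 3) K) :
    (lineRestrict x u F).natDegree ≤ F.totalDegree := by
  have h := MvPolynomial.aeval_natDegree_le (m := F.totalDegree) (n := 1) F le_rfl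
    (fun i => Polynomial.C (x i) + Polynomial.C (u i) * Polynomial.X) (fun i => by
      compute_degree)
  simpa [lineRestrict] using h

theorem derivative_lineRestrict (x u : Fin 3 → K) (F : MvPolynomial (Fin 3) K) :
    Polynomial.derivative (lineRestrict x u F) =
      ∑ i, Polynomial.C (u i) * lineRestrict x u (MvPolynomial.pderiv i F) := by
  induction F using MvPolynomial.induction_on with
  | C a => simp [lineRestrict]
  | add p q hp hq => simp [hp, hq, mul_add, Finset.sum_add_distrib]
  | mul_X p i hp =>
    have hX : Polynomial.derivative (lineRestrict x u (MvPolynomial.X i)) =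
        Polynomial.C (u i) := by simp [lineRestrict]
    have hd : ∀ j, lineRestrict x u (MvPolynomial.pderiv j (MvPolynomial.X i)) =
        if j = i then 1 else 0 := fun j => by
      rw [MvPolynomial.pderiv_X]
      split_ifs with h
      · subst h; simp
      · simp [Ne.symm h]
    simp only [map_mul, Polynomial.derivative_mul, hp, MvPolynomial.pderiv_mul, map_add, mul_add,
      Finset.sum_add_distrib, Finset.sum_mul, hX, hd]
    refine congrArg₂ (· + ·) (Finset.sum_congr rfl fun j _ => by ring) ?_
    simp [mul_comm]

theorem pderiv_pderiv_comm {σ R : Type*} [CommSemiring R] (i j : σ) (F : MvPolynomial σ R) :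
    MvPolynomial.pderiv i (MvPolynomial.pderiv j F) =
      MvPolynomial.pderiv j (MvPolynomial.pderiv i F) := by
  classical
  ext m
  simp only [MvPolynomial.coeff_pderiv]
  rw [add_right_comm]
  by_cases h : i = j
  · subst h; rfl
  · simp [h, Ne.symm h]
    ring

theorem totalDegree_pderiv_le {σ R : Type*} [CommSemiring R] (i : σ) (F : MvPolynomial σ R) :
    (MvPolynomial.pderiv i F).totalDegree ≤ F.totalDegree - 1 := by
  classical
  rw [MvPolynomial.totalDegree, Finset.sup_le_iff]
  intro m hm
  rw [MvPolynomial.mem_support_iff, MvPolynomial.coeff_pderiv] at hm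
  have h := MvPolynomial.le_totalDegree (MvPolynomial.mem_support_iff.2 (left_ne_zero_of_mul hm))
  rw [Finsupp.sum_add_index' (by simp) (by simp), Finsupp.sum_single_index rfl] at h
  omega

theorem totalDegree_eq_zero_of_pderiv_eq_zero {σ : Type*} (p : ℕ) [CharP K p]
    {F : MvPolynomial σ K} (hdeg : F.totalDegree < p)
    (h : ∀ i, MvPolynomial.pderiv i F = 0) : F.totalDegree = 0 := by
  classical
  rw [MvPolynomial.totalDegree, ← Nat.bot_eq_zero, Finset.sup_eq_bot_iff]
  intro m hm
  have hle := MvPolynomial.le_totalDegree hm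
  rw [MvPolynomial.mem_support_iff] at hm
  have hm0 : m = 0 := by
    by_contra hm0
    obtain ⟨i, hi⟩ := Finsupp.ne_iff.1 hm0
    have hi' : 0 < m i := Nat.pos_of_ne_zero hi
    have hc := congrArg (MvPolynomial.coeff (m - Finsupp.single i 1)) (h i)
    rw [MvPolynomial.coeff_pderiv, tsub_add_cancel_of_le (by simpa using Nat.one_le_iff_ne_zero.2 hi)] at hc
    have hcast : ((m i : ℕ) : K) = 0 := by
      rw [MvPolynomial.coeff_zero, mul_eq_zero] at hc
      rw [← hc.resolve_left hm, Finsupp.tsub_apply, Finsupp.single_eq_same, Nat.cast_sub hi']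
      simp
    have hdvd := Nat.le_of_dvd hi' ((CharP.cast_eq_zero_iff K p _).1 hcast)
    have : m i ≤ m.sum fun _ e => e :=
      Finset.single_le_sum (f := fun j => m j) (fun _ _ => Nat.zero_le _)
        (Finsupp.mem_support_iff.2 hi)
    omega
  simp [hm0]

theorem exists_eq_C_mul_of_derivative_mul_eq (p : ℕ) [CharP K p] {a b : Polynomial K}
    (ha : a.natDegree < p) (hb : b.natDegree < p) (hb0 : b ≠ 0)
    (h : Polynomial.derivative a * b = Polynomial.derivative b * a) :
    ∃ c : K, a = Polynomial.C c * b := by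
  have key : ∀ q : Polynomial K, q ≠ 0 → q.natDegree < p →
      Polynomial.derivative q * b = Polynomial.derivative b * q → q.natDegree = b.natDegree := by
    intro q hq0 hq h
    have hlead : ∀ r s : Polynomial K,
        (Polynomial.derivative r * s).coeff (r.natDegree + s.natDegree - 1) =
          r.natDegree * (r.leadingCoeff * s.leadingCoeff) := by
      intro r s
      rcases Nat.eq_zero_or_pos r.natDegree with hr | hr
      · have : Polynomial.derivative r = 0 := Polynomial.derivative_of_natDegree_zero hr
        simp [this, hr]
      · have hr1 : r.natDegree + s.natDegree - 1 = (r.natDegree - 1) + s.natDegree := by omega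
        rw [hr1, Polynomial.coeff_mul_add_eq_of_natDegree_le
          (Polynomial.natDegree_derivative_le r) le_rfl, Polynomial.coeff_derivative,
          Nat.sub_add_cancel hr, Polynomial.leadingCoeff, Polynomial.leadingCoeff,
          Nat.cast_sub hr]
        push_cast
        ring
    have h1 := hlead q b
    have h2 := hlead b q
    rw [h, add_comm, h2] at h1
    have hne : q.leadingCoeff * b.leadingCoeff ≠ 0 := by simp [hq0, hb0]
    have h3 : ((b.natDegree : ℕ) : K) = (q.natDegree : K) := by
      apply mul_right_cancel₀ hne
      rw [← h1]; ring
    exact (CharP.natCast_injOn_Iio K p hb hq h3).symm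
  by_cases ha0 : a = 0
  · exact ⟨0, by simp [ha0]⟩
  have hab := key a ha0 ha h
  refine ⟨a.leadingCoeff / b.leadingCoeff, ?_⟩
  by_contra hne
  set c := a.leadingCoeff / b.leadingCoeff with hc
  have hq0 : a - Polynomial.C c * b ≠ 0 := sub_ne_zero.2 hne
  have hc0 : c ≠ 0 := by simp [hc, ha0, hb0]
  have hlt : (a - Polynomial.C c * b).degree < a.degree := by
    apply Polynomial.degree_sub_lt_left _ ha0
    · simp [hc, hb0]
    · rw [Polynomial.degree_C_mul hc0, Polynomial.degree_eq_natDegree ha0,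
        Polynomial.degree_eq_natDegree hb0, hab]
  have hlt' := Polynomial.natDegree_lt_natDegree hq0 hlt
  have := key _ hq0 (hlt'.trans ha) (by simp only [Polynomial.derivative_sub,
    Polynomial.derivative_C_mul, sub_mul, mul_sub, h]; ring)
  omega

end LineRestriction

section Geometry

variable {K : Type*} [Field K]

theorem cross_eq_zero_of_dotProduct_eq_zero {g v a b : Fin 3 → K}
    (hab : LinearIndependent K ![a, b]) (hga : g ⬝ᵥ a = 0) (hgb : g ⬝ᵥ b = 0)
    (hva : v ⬝ᵥ a = 0) (hvb : v ⬝ᵥ b = 0) : ∀ i j, g i * v j = g j * v i := by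
  by_contra! hne
  obtain ⟨i, j, hne⟩ := hne
  have hgv : LinearIndependent K ![g, v] := by
    rw [LinearIndependent.pair_iff]
    intro s t hst
    have h1 := congrFun hst i
    have h2 := congrFun hst j
    simp only [Pi.add_apply, Pi.smul_apply, smul_eq_mul, Pi.zero_apply] at h1 h2
    have hs : s * (g i * v j - g j * v i) = 0 := by linear_combination v j * h1 - v i * h2
    have ht : t * (g i * v j - g j * v i) = 0 := by linear_combination g i * h2 - g j * h1
    exact ⟨(mul_eq_zero.1 hs).resolve_right (sub_ne_zero.2 hne),
      (mul_eq_zero.1 ht).resolve_right (sub_ne_zero.2 hne)⟩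
  have hrank := LinearMap.finrank_range_add_finrank_ker (Matrix.mulVecLin (Matrix.of ![g, v]))
  have h1 : (Matrix.of ![g, v]).rank = 2 := by
    simpa using LinearIndependent.rank_matrix (M := Matrix.of ![g, v]) hgv
  rw [Matrix.rank] at h1
  have h2 : 2 ≤ Module.finrank K (LinearMap.ker (Matrix.mulVecLin (Matrix.of ![g, v]))) := by
    have hmem : ∀ k, ![a, b] k ∈ LinearMap.ker (Matrix.mulVecLin (Matrix.of ![g, v])) := by
      intro k
      rw [LinearMap.mem_ker]
      ext l
      fin_cases k <;> fin_cases l <;> simpa [Matrix.mulVec]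
    have hli : LinearIndependent K
        (fun k => (⟨![a, b] k, hmem k⟩ : LinearMap.ker (Matrix.mulVecLin (Matrix.of ![g, v])))) :=
      LinearIndependent.of_comp (Submodule.subtype _) hab
    simpa using hli.fintype_card_le_finrank
  rw [h1, Module.finrank_fin_fun] at hrank
  omega

theorem exists_linear_relation {g u₁ u₂ u₃ : Fin 3 → K} (hg : g ≠ 0)
    (h₁ : g ⬝ᵥ u₁ = 0) (h₂ : g ⬝ᵥ u₂ = 0) (h₃ : g ⬝ᵥ u₃ = 0)
    (h₁₂ : LinearIndependent K ![u₁, u₂]) : ∃ α β : K, u₃ = α • u₁ + β • u₂ := by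
  have hdet : ¬ LinearIndependent K ![u₃, u₁, u₂] := by
    intro h
    have hM : IsUnit (Matrix.of ![u₃, u₁, u₂]) :=
      Matrix.linearIndependent_rows_iff_isUnit.1 h
    apply hg
    apply Matrix.mulVec_injective_of_isUnit hM
    ext l
    rw [Matrix.mulVec_zero]
    fin_cases l <;> simpa [Matrix.mulVec, dotProduct_comm]
  have := mt (linearIndependent_finCons (v := ![u₁, u₂]) (x := u₃)).2 hdet
  rw [not_and_not_right] at this
  have hmem := this h₁₂
  simp only [Matrix.range_cons, Matrix.range_empty, Set.union_empty, Set.singleton_union,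
    Submodule.mem_span_pair] at hmem
  obtain ⟨α, β, h⟩ := hmem
  exact ⟨α, β, h.symm⟩

/-- If three pairwise non-parallel vectors orthogonal to `g ≠ 0` are isotropic for a symmetric
form `H`, then `H u` is proportional to `g` for each of them. -/
theorem cross_mulVec_eq_zero_of_isotropic (h2 : (2 : K) ≠ 0) {g u₁ u₂ u₃ : Fin 3 → K}
    {H : Matrix (Fin 3) (Fin 3) K} (hH : H.IsSymm)
    (hg₁ : g ⬝ᵥ u₁ = 0) (hg₂ : g ⬝ᵥ u₂ = 0) (hg₃ : g ⬝ᵥ u₃ = 0)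
    (hH₁ : H.mulVec u₁ ⬝ᵥ u₁ = 0) (hH₂ : H.mulVec u₂ ⬝ᵥ u₂ = 0) (hH₃ : H.mulVec u₃ ⬝ᵥ u₃ = 0)
    (h₁₂ : LinearIndependent K ![u₁, u₂]) (h₁₃ : LinearIndependent K ![u₁, u₃])
    (h₂₃ : LinearIndependent K ![u₂, u₃]) :
    ∀ i j, g i * H.mulVec u₁ j = g j * H.mulVec u₁ i := by
  by_cases hg : g = 0
  · simp [hg]
  obtain ⟨α, β, rfl⟩ := exists_linear_relation hg hg₁ hg₂ hg₃ h₁₂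
  have hα : α ≠ 0 := by
    rintro rfl
    have := LinearIndependent.pair_iff.1 h₂₃ β (-1) (by simp)
    simp at this
  have hβ : β ≠ 0 := by
    rintro rfl
    have := LinearIndependent.pair_iff.1 h₁₃ α (-1) (by simp)
    simp at this
  have hsymm : H.mulVec u₂ ⬝ᵥ u₁ = H.mulVec u₁ ⬝ᵥ u₂ := by
    rw [dotProduct_comm, Matrix.dotProduct_mulVec, ← Matrix.mulVec_transpose, hH.eq]
  have h0 : 2 * (α * β) * (H.mulVec u₁ ⬝ᵥ u₂) = 0 := by
    simp only [Matrix.mulVec_add, Matrix.mulVec_smul, add_dotProduct, dotProduct_add,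
      smul_dotProduct, dotProduct_smul, smul_eq_mul, hH₁, hH₂, hsymm] at hH₃
    linear_combination hH₃
  exact cross_eq_zero_of_dotProduct_eq_zero h₁₂ hg₁ hg₂ hH₁
    ((mul_eq_zero.1 h0).resolve_left (mul_ne_zero h2 (mul_ne_zero hα hβ)))

theorem exists_vanishing_polynomial (S : Set (Fin 3 → K)) (hS : S.Finite) (m : ℕ)
    (hm : S.ncard < m ^ 3) :
    ∃ F : MvPolynomial (Fin 3) K, F ≠ 0 ∧ F.totalDegree ≤ 3 * (m - 1) ∧
      ∀ x ∈ S, MvPolynomial.eval x F = 0 := by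
  classical
  have := hS.fintype
  let e : (Fin 3 → Fin m) → (Fin 3 →₀ ℕ) := fun k => Finsupp.equivFunOnFinite.symm fun i => k i
  have he : Function.Injective e := fun k l h => by
    ext i
    simpa [e] using DFunLike.congr_fun h i
  let Φ : ((Fin 3 → Fin m) → K) →ₗ[K] MvPolynomial (Fin 3) K :=
    ∑ k, (MvPolynomial.monomial (e k)).comp (LinearMap.proj k)
  have hΦ : ∀ c, Φ c = ∑ k, MvPolynomial.monomial (e k) (c k) := fun c => by simp [Φ]
  let ev : MvPolynomial (Fin 3) K →ₗ[K] (S → K) :=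
    LinearMap.pi fun x => (MvPolynomial.aeval (x : Fin 3 → K)).toLinearMap
  have hker : LinearMap.ker (ev.comp Φ) ≠ ⊥ := by
    apply LinearMap.ker_ne_bot_of_finrank_lt
    rw [Module.finrank_fintype_fun_eq_card, Module.finrank_fintype_fun_eq_card]
    rw [Set.ncard_eq_toFinset_card', Set.toFinset_card] at hm
    simpa using hm
  obtain ⟨c, hc, hc0⟩ := Submodule.exists_mem_ne_zero_of_ne_bot hker
  refine ⟨Φ c, ?_, ?_, ?_⟩
  · obtain ⟨k, hk⟩ := Function.ne_iff.1 hc0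
    intro h0
    apply hk
    have := congrArg (MvPolynomial.coeff (e k)) h0
    simpa [hΦ, MvPolynomial.coeff_sum, MvPolynomial.coeff_monomial, he.eq_iff] using this
  · rw [hΦ]
    refine MvPolynomial.totalDegree_finsetSum_le fun k _ => ?_
    refine (MvPolynomial.totalDegree_monomial_le _ _).trans ?_
    rw [Finsupp.sum_fintype _ _ (by simp), Fin.sum_univ_three]
    have h0 := (k 0).2
    have h1 := (k 1).2
    have h2 := (k 2).2
    simp only [e, Finsupp.equivFunOnFinite_symm_apply_apply, id_eq]
    omega
  · intro x hx
    have := congrFun (LinearMap.mem_ker.1 hc) ⟨x, hx⟩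
    simpa [ev, MvPolynomial.aeval_eq_eval] using this

end Geometry

open Classical in
/-- A family of sets covering few points contains a nonempty subfamily each of whose members
consists mostly of points of multiplicity at least three. -/
theorem exists_subfamily_of_multiplicity {V : Type*} [Fintype V] (L : Finset (Set V)) (p : ℕ)
    (h : 8 * (⋃₀ (L : Set (Set V))).ncard < p * L.card) :
    ∃ A ⊆ L, A.Nonempty ∧
      ∀ ℓ ∈ A, 4 * {x ∈ ℓ | (A.filter (x ∈ ·)).card ≤ 2}.ncard ≤ p := by
  let f : Finset (Set V) → ℕ := fun A => ∑ x, min (A.filter (x ∈ ·)).card 2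
  obtain ⟨A, hA, hmax⟩ := Finset.exists_max_image L.powerset
    (fun A => (p * A.card : ℤ) - 4 * f A) ⟨∅, Finset.empty_mem_powerset L⟩
  rw [Finset.mem_powerset] at hA
  have hfL : f L ≤ 2 * (⋃₀ (L : Set (Set V))).ncard := by
    calc f L ≤ ∑ x, if x ∈ ⋃₀ (L : Set (Set V)) then 2 else 0 := by
          refine Finset.sum_le_sum fun x _ => ?_
          split_ifs with hx
          · exact min_le_right _ _
          · have : L.filter (x ∈ ·) = ∅ :=
              Finset.filter_eq_empty_iff.2 fun ℓ hℓ hxℓ => hx ⟨ℓ, hℓ, hxℓ⟩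
            simp [this]
      _ = _ := by
          rw [← Finset.sum_filter, Finset.sum_const, smul_eq_mul, mul_comm,
            Set.ncard_eq_toFinset_card']
          congr 2
          ext; simp
  refine ⟨A, hA, ?_, fun ℓ hℓ => ?_⟩
  · by_contra hne
    rw [Finset.not_nonempty_iff_eq_empty] at hne
    have := hmax L (Finset.mem_powerset_self L)
    have hf0 : f ∅ = 0 := by simp [f]
    rw [hne, hf0] at this
    simp only [Finset.card_empty] at this
    zify at h hfL
    push_cast at this
    linarith
  · have hB := hmax (A.erase ℓ) (Finset.mem_powerset.2 ((Finset.erase_subset _ _).trans hA))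
    have hcard := Finset.card_erase_add_one hℓ
    have hf : f (A.erase ℓ) + {x ∈ ℓ | (A.filter (x ∈ ·)).card ≤ 2}.ncard ≤ f A := by
      have hn : {x ∈ ℓ | (A.filter (x ∈ ·)).card ≤ 2}.ncard =
          ∑ x, if x ∈ ℓ ∧ (A.filter (x ∈ ·)).card ≤ 2 then 1 else 0 := by
        rw [← Finset.sum_filter, Finset.sum_const, smul_eq_mul, mul_one,
          Set.ncard_eq_toFinset_card']
        congr 1
        ext; simp
      rw [hn, ← Finset.sum_add_distrib]
      refine Finset.sum_le_sum fun x _ => ?_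
      rw [Finset.filter_erase]
      split_ifs with hx
      · have := Finset.card_erase_add_one (show ℓ ∈ A.filter (x ∈ ·) from
          Finset.mem_filter.2 ⟨hℓ, hx.1⟩)
        omega
      · have := Finset.card_le_card (Finset.erase_subset ℓ (A.filter (x ∈ ·)))
        omega
    zify at hcard hf ⊢
    rw [← hcard] at hB
    linarith

section Lines

variable {K : Type*} [Field K]

/-- The line through `x` with direction `u`. -/
def affineLine (x u : Fin 3 → K) : Set (Fin 3 → K) := {y | ∃ t : K, y = x + t • u}

theorem affineLine_eq_of_mem {x y u : Fin 3 → K} (h : y ∈ affineLine x u) :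
    affineLine y u = affineLine x u := by
  obtain ⟨s, rfl⟩ := h
  ext z
  constructor
  · rintro ⟨t, rfl⟩
    exact ⟨s + t, by rw [add_smul, add_assoc]⟩
  · rintro ⟨t, rfl⟩
    exact ⟨t - s, by rw [sub_smul]; abel⟩

theorem linearIndependent_of_affineLine_ne {x u w : Fin 3 → K} (hu : u ≠ 0) (hw : w ≠ 0)
    (h : affineLine x u ≠ affineLine x w) : LinearIndependent K ![u, w] := by
  rw [LinearIndependent.pair_iff' hu]
  rintro a rfl
  have ha : a ≠ 0 := fun ha => hw (by simp [ha])
  apply h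
  ext z
  constructor
  · rintro ⟨t, rfl⟩
    exact ⟨t / a, by rw [smul_smul, div_mul_cancel₀ _ ha]⟩
  · rintro ⟨t, rfl⟩
    exact ⟨t * a, by rw [smul_smul]⟩

theorem affineLine_eq_of_mem_of_mem {P u Q w x y : Fin 3 → K} (hu : u ≠ 0) (hw : w ≠ 0)
    (hxy : x ≠ y) (hx : x ∈ affineLine P u) (hy : y ∈ affineLine P u)
    (hx' : x ∈ affineLine Q w) (hy' : y ∈ affineLine Q w) :
    affineLine P u = affineLine Q w := by
  rw [← affineLine_eq_of_mem hx] at hy ⊢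
  rw [← affineLine_eq_of_mem hx'] at hy' ⊢
  by_contra hne
  have hli := linearIndependent_of_affineLine_ne hu hw hne
  obtain ⟨t, rfl⟩ := hy
  obtain ⟨s, hs⟩ := hy'
  have := LinearIndependent.pair_iff.1 hli t (-s) (by
    rw [neg_smul, ← sub_eq_add_neg, sub_eq_zero]
    exact add_left_cancel hs)
  exact hxy (by simp [this.1])

/-- The gradient of `F` at `x`. -/
noncomputable def gradientAt (F : MvPolynomial (Fin 3) K) (x : Fin 3 → K) : Fin 3 → K :=
  fun i => MvPolynomial.eval x (MvPolynomial.pderiv i F)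

/-- The Hessian matrix of `F` at `x`. -/
noncomputable def hessianAt (F : MvPolynomial (Fin 3) K) (x : Fin 3 → K) :
    Matrix (Fin 3) (Fin 3) K :=
  Matrix.of fun i j => MvPolynomial.eval x (MvPolynomial.pderiv i (MvPolynomial.pderiv j F))

theorem hessianAt_isSymm (F : MvPolynomial (Fin 3) K) (x : Fin 3 → K) :
    (hessianAt F x).IsSymm := by
  ext i j
  simp [hessianAt, pderiv_pderiv_comm i j]

theorem eval_derivative_lineRestrict (x u : Fin 3 → K) (F : MvPolynomial (Fin 3) K) (t : K) :
    (Polynomial.derivative (lineRestrict x u F)).eval t = gradientAt F (x + t • u) ⬝ᵥ u := by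
  simp [derivative_lineRestrict, Polynomial.eval_finsetSum, eval_lineRestrict, gradientAt,
    dotProduct, mul_comm]

theorem eval_derivative_lineRestrict_pderiv (x u : Fin 3 → K) (F : MvPolynomial (Fin 3) K)
    (t : K) (j : Fin 3) :
    (Polynomial.derivative (lineRestrict x u (MvPolynomial.pderiv j F))).eval t =
      (hessianAt F (x + t • u)).mulVec u j := by
  simp [eval_derivative_lineRestrict, gradientAt, hessianAt, Matrix.mulVec, dotProduct,
    pderiv_pderiv_comm j]

theorem lineRestrict_eq_zero [Fintype K] {F : MvPolynomial (Fin 3) K} {x u : Fin 3 → K}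
    (hdeg : F.totalDegree < Fintype.card K)
    (h : ∀ y ∈ affineLine x u, MvPolynomial.eval y F = 0) : lineRestrict x u F = 0 :=
  Polynomial.eq_zero_of_natDegree_lt_card_of_eval_eq_zero' _ Finset.univ
    (fun t _ => by rw [eval_lineRestrict]; exact h _ ⟨t, rfl⟩)
    ((natDegree_lineRestrict_le _ _ _).trans_lt hdeg)

theorem gradientAt_dotProduct_eq_zero {F : MvPolynomial (Fin 3) K} {x u : Fin 3 → K}
    (h : lineRestrict x u F = 0) : gradientAt F x ⬝ᵥ u = 0 := by
  simpa [h] using (eval_derivative_lineRestrict x u F 0).symm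

theorem hessianAt_mulVec_dotProduct_eq_zero {F : MvPolynomial (Fin 3) K} {x u : Fin 3 → K}
    (h : lineRestrict x u F = 0) : (hessianAt F x).mulVec u ⬝ᵥ u = 0 := by
  have h1 := derivative_lineRestrict x u F
  rw [h, Polynomial.derivative_zero] at h1
  have h2 := congrArg (fun q => (Polynomial.derivative q).eval 0) h1
  simp only [Polynomial.derivative_zero, Polynomial.eval_zero, Polynomial.derivative_sum,
    Polynomial.derivative_C_mul, Polynomial.eval_finsetSum, Polynomial.eval_mul,
    Polynomial.eval_C, eval_derivative_lineRestrict_pderiv, zero_smul, add_zero] at h2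
  rw [dotProduct_comm]
  exact h2.symm

/-- At a point lying on three lines inside the zero set of `F`, the derivative of the gradient
along each of the lines is proportional to the gradient. -/
theorem gradientAt_mul_hessianAt_comm [Fintype K] (h2 : (2 : K) ≠ 0)
    {F : MvPolynomial (Fin 3) K} (hdeg : F.totalDegree < Fintype.card K)
    {A : Finset (Set (Fin 3 → K))} [DecidableEq (Set (Fin 3 → K))]
    (hA : ∀ ℓ ∈ A, ∃ P Q : Fin 3 → K, Q ≠ 0 ∧ ℓ = affineLine P Q)
    (hF : ∀ ℓ ∈ A, ∀ x ∈ ℓ, MvPolynomial.eval x F = 0) {x u : Fin 3 → K} (hu : u ≠ 0)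
    (hℓ : affineLine x u ∈ A) [DecidablePred fun ℓ : Set (Fin 3 → K) => x ∈ ℓ]
    (hx : 3 ≤ (A.filter (x ∈ ·)).card) (i j : Fin 3) :
    gradientAt F x i * (hessianAt F x).mulVec u j =
      gradientAt F x j * (hessianAt F x).mulVec u i := by
  have hmem : affineLine x u ∈ A.filter (x ∈ ·) :=
    Finset.mem_filter.2 ⟨hℓ, 0, by simp⟩
  have hcard := Finset.card_erase_add_one hmem
  obtain ⟨m, n, hm, hn, hmn⟩ := Finset.one_lt_card_iff.1
    (show 1 < ((A.filter (x ∈ ·)).erase (affineLine x u)).card by omega)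
  simp only [Finset.mem_erase, Finset.mem_filter] at hm hn
  obtain ⟨hmℓ, hmA, hxm⟩ := hm
  obtain ⟨hnℓ, hnA, hxn⟩ := hn
  obtain ⟨P, v, hv, rfl⟩ := hA m hmA
  obtain ⟨Q, w, hw, rfl⟩ := hA n hnA
  rw [← affineLine_eq_of_mem hxm] at hmℓ hmA hmn
  rw [← affineLine_eq_of_mem hxn] at hnℓ hnA hmn
  have hu0 := lineRestrict_eq_zero hdeg (hF _ hℓ)
  have hv0 := lineRestrict_eq_zero hdeg (hF _ hmA)
  have hw0 := lineRestrict_eq_zero hdeg (hF _ hnA)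
  exact cross_mulVec_eq_zero_of_isotropic h2 (hessianAt_isSymm F x)
    (gradientAt_dotProduct_eq_zero hu0) (gradientAt_dotProduct_eq_zero hv0)
    (gradientAt_dotProduct_eq_zero hw0) (hessianAt_mulVec_dotProduct_eq_zero hu0)
    (hessianAt_mulVec_dotProduct_eq_zero hv0) (hessianAt_mulVec_dotProduct_eq_zero hw0)
    (linearIndependent_of_affineLine_ne hu hv hmℓ.symm)
    (linearIndependent_of_affineLine_ne hu hw hnℓ.symm)
    (linearIndependent_of_affineLine_ne hv hw hmn) i j

end Lines

open Classical in
/-- If each line of `A` consists mostly of points of multiplicity at least three and no plane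
contains more than `p` lines of `A`, then the gradient of a polynomial of small degree vanishing
on `A` vanishes on `A` as well. -/
theorem gradientAt_eq_zero_of_multiplicity {p : ℕ} [Fact p.Prime] (hp : 2 < p)
    {A : Finset (Set (Fin 3 → ZMod p))}
    (hA : ∀ ℓ ∈ A, ∃ P Q : Fin 3 → ZMod p, Q ≠ 0 ∧ ℓ = affineLine P Q)
    (hplane : ∀ (w : Fin 3 → ZMod p) (b : ZMod p), w ≠ 0 →
      (A.filter (· ⊆ {x | w ⬝ᵥ x = b})).card ≤ p)
    (hmult : ∀ ℓ ∈ A, 4 * {x ∈ ℓ | (A.filter (x ∈ ·)).card ≤ 2}.ncard ≤ p)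
    {F : MvPolynomial (Fin 3) (ZMod p)} (hdeg : 100 * F.totalDegree ≤ 3 * p)
    (hF : ∀ ℓ ∈ A, ∀ x ∈ ℓ, MvPolynomial.eval x F = 0) :
    ∀ ℓ ∈ A, ∀ x ∈ ℓ, gradientAt F x = 0 := by
  intro ℓ hℓ
  obtain ⟨P, u, hu, rfl⟩ := hA ℓ hℓ
  have h2 : (2 : ZMod p) ≠ 0 := by
    intro h
    have := Nat.le_of_dvd two_pos ((ZMod.natCast_eq_zero_iff 2 p).1 (by exact_mod_cast h))
    omega
  have hdeg' : F.totalDegree < Fintype.card (ZMod p) := by rw [ZMod.card]; omega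
  have hinj : Function.Injective fun t : ZMod p => P + t • u := fun s t h =>
    smul_left_injective _ hu (add_left_cancel h)
  let R : Finset (ZMod p) := Finset.univ.filter fun t => 3 ≤ (A.filter (P + t • u ∈ ·)).card
  have hR : 3 * p ≤ 4 * R.card := by
    have h1 := hmult _ hℓ
    have h2 : Rᶜ.card ≤ {x ∈ affineLine P u | (A.filter (x ∈ ·)).card ≤ 2}.ncard := by
      rw [← Finset.card_image_of_injective _ hinj, ← Set.ncard_coe_finset]
      refine Set.ncard_le_ncard (fun x hx => ?_) (Set.toFinite _)
      simp only [Finset.coe_image, Set.mem_image, Finset.mem_coe, Finset.mem_compl, R,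
        Finset.mem_filter, Finset.mem_univ, true_and, not_le] at hx
      obtain ⟨t, ht, rfl⟩ := hx
      exact ⟨⟨t, rfl⟩, by omega⟩
    have h3 := Finset.card_add_card_compl R
    rw [ZMod.card] at h3
    omega
  let g : Fin 3 → Polynomial (ZMod p) := fun i => lineRestrict P u (MvPolynomial.pderiv i F)
  have hgdeg : ∀ i, (g i).natDegree ≤ F.totalDegree := fun i =>
    (natDegree_lineRestrict_le _ _ _).trans ((totalDegree_pderiv_le i F).trans (Nat.sub_le _ _))
  have hgeval : ∀ i t, (g i).eval t = gradientAt F (P + t • u) i := fun i t =>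
    eval_lineRestrict _ _ _ _
  have hwronskian : ∀ i j,
      Polynomial.derivative (g i) * g j = Polynomial.derivative (g j) * g i := by
    intro i j
    rw [← sub_eq_zero]
    refine Polynomial.eq_zero_of_natDegree_lt_card_of_eval_eq_zero' _ R (fun t ht => ?_) ?_
    · have hmem : P + t • u ∈ affineLine P u := ⟨t, rfl⟩
      have := gradientAt_mul_hessianAt_comm h2 hdeg' hA hF hu
        (by rwa [affineLine_eq_of_mem hmem]) (Finset.mem_filter.1 ht).2 i j
      rw [Polynomial.eval_sub, Polynomial.eval_mul, Polynomial.eval_mul, hgeval, hgeval,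
        eval_derivative_lineRestrict_pderiv, eval_derivative_lineRestrict_pderiv]
      linear_combination -this
    · have hmul : ∀ i j, (Polynomial.derivative (g i) * g j).natDegree ≤ 2 * F.totalDegree := by
        intro i j
        refine Polynomial.natDegree_mul_le.trans ?_
        have := Polynomial.natDegree_derivative_le (g i)
        have := hgdeg i
        have := hgdeg j
        omega
      have := (Polynomial.natDegree_sub_le_of_le (hmul i j) (hmul j i))
      rw [max_self] at this
      omega
  by_cases hg : ∀ i, g i = 0
  · rintro _ ⟨t, rfl⟩
    ext i
    rw [← hgeval, hg i]
    simp
  exfalso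
  push Not at hg
  obtain ⟨j, hj⟩ := hg
  have hlt : ∀ i, (g i).natDegree < p := fun i => (hgdeg i).trans_lt (by omega)
  choose w hw using fun i =>
    exists_eq_C_mul_of_derivative_mul_eq p (hlt i) (hlt j) hj (hwronskian i j)
  have hw0 : w ≠ 0 := by
    rintro rfl
    exact hj (by simpa using hw j)
  let T : Finset (ZMod p) := R.filter fun t => (g j).eval t ≠ 0
  have hT : R.card ≤ T.card + F.totalDegree := by
    rw [← Finset.card_filter_add_card_filter_not (s := R) fun t => (g j).eval t ≠ 0]
    gcongr
    refine le_trans (Finset.card_le_card (t := (g j).roots.toFinset) fun t ht => ?_)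
      ((Multiset.toFinset_card_le _).trans ((Polynomial.card_roots' _).trans (hgdeg j)))
    simp only [Finset.mem_filter, not_not] at ht
    simp [hj, ht.2]
  have hwu : ∀ t ∈ T, ∀ v Q, P + t • u ∈ affineLine Q v → affineLine Q v ∈ A → w ⬝ᵥ v = 0 := by
    intro t ht v Q hmem hQ
    rw [← affineLine_eq_of_mem hmem] at hQ
    have h0 := gradientAt_dotProduct_eq_zero (lineRestrict_eq_zero hdeg' (hF _ hQ))
    have hgrad : gradientAt F (P + t • u) = (g j).eval t • w := by
      ext i
      rw [← hgeval, hw i]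
      simp [mul_comm]
    rw [hgrad, smul_dotProduct, smul_eq_mul] at h0
    exact (mul_eq_zero.1 h0).resolve_left (Finset.mem_filter.1 ht).2
  let B : ZMod p → Finset (Set (Fin 3 → ZMod p)) := fun t =>
    (A.filter (P + t • u ∈ ·)).erase (affineLine P u)
  have hBcard : ∀ t ∈ T, 2 ≤ (B t).card := by
    intro t ht
    have h3 := (Finset.mem_filter.1 (Finset.mem_filter.1 ht).1).2
    have := Finset.card_erase_add_one
      (show affineLine P u ∈ A.filter (P + t • u ∈ ·) from Finset.mem_filter.2 ⟨hℓ, t, rfl⟩)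
    simp only [B]
    omega
  have hBdisj : (T : Set (ZMod p)).PairwiseDisjoint B := by
    intro s _ t _ hst
    rw [Function.onFun, Finset.disjoint_left]
    intro m hms hmt
    simp only [B, Finset.mem_erase, Finset.mem_filter] at hms hmt
    obtain ⟨Q, v, hv, rfl⟩ := hA m hms.2.1
    exact hms.1 (affineLine_eq_of_mem_of_mem hv hu (hinj.ne hst) hms.2.2 hmt.2.2
      ⟨s, rfl⟩ ⟨t, rfl⟩)
  have hsub : T.biUnion B ⊆ A.filter (· ⊆ {x | w ⬝ᵥ x = w ⬝ᵥ P}) := by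
    intro m hm
    obtain ⟨t, ht, hmt⟩ := Finset.mem_biUnion.1 hm
    simp only [B, Finset.mem_erase, Finset.mem_filter] at hmt
    refine Finset.mem_filter.2 ⟨hmt.2.1, ?_⟩
    obtain ⟨Q, v, hv, rfl⟩ := hA m hmt.2.1
    have hv0 := hwu t ht v Q hmt.2.2 hmt.2.1
    have hu0 := hwu t ht u P ⟨t, rfl⟩ hℓ
    rw [← affineLine_eq_of_mem hmt.2.2]
    rintro _ ⟨s, rfl⟩
    simp [dotProduct_add, hv0, hu0]
  have h1 := (Finset.card_le_card hsub).trans (hplane w _ hw0)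
  rw [Finset.card_biUnion hBdisj] at h1
  have h3 := Finset.card_nsmul_le_sum T (fun t => (B t).card) 2 hBcard
  rw [smul_eq_mul] at h3
  omega

/-- Guth–Katz over `F_p`: there is an absolute constant `c > 0` such that for every
prime `p`, if `L` is a set of `p²` (affine) lines in `F_p³` with at most `p` of them
lying in any plane, then the union of the lines of `L` has at least `c p³` points. -/
theorem guth_katz_prime_field :
    ∃ c : ℝ, 0 < c ∧ ∀ p : ℕ, p.Prime →
      ∀ L : Set (Set (Fin 3 → ZMod p)),
        (∀ ℓ ∈ L, ∃ P Q : Fin 3 → ZMod p, Q ≠ 0 ∧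
          ℓ = {x | ∃ t : ZMod p, x = P + t • Q}) →
        L.ncard = p ^ 2 →
        (∀ H : Set (Fin 3 → ZMod p),
          (∃ (a : Fin 3 → ZMod p) (b : ZMod p), a ≠ 0 ∧
            H = {x | ∑ i, a i * x i = b}) →
          {ℓ ∈ L | ℓ ⊆ H}.ncard ≤ p) →
        c * (p : ℝ) ^ 3 ≤ ((⋃₀ L).ncard : ℝ) := by
  classical
  refine ⟨1 / 10 ^ 6, by norm_num, fun p hp L hL hcard hplane => ?_⟩
  have : Fact p.Prime := ⟨hp⟩
  by_contra! hlt
  have hlt' : 10 ^ 6 * (⋃₀ L).ncard < p ^ 3 := by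
    have : (10 ^ 6 * (⋃₀ L).ncard : ℝ) < (p : ℝ) ^ 3 := by linarith
    exact_mod_cast this
  obtain ⟨A, hAL, hAne, hmult⟩ := exists_subfamily_of_multiplicity L.toFinset p (by
    rw [Set.coe_toFinset, ← Set.ncard_eq_toFinset_card', hcard]
    have : p * p ^ 2 = p ^ 3 := by ring
    omega)
  have hAL' : ∀ ℓ ∈ A, ℓ ∈ L := fun ℓ hℓ => Set.mem_toFinset.1 (hAL hℓ)
  have hA : ∀ ℓ ∈ A, ∃ P Q : Fin 3 → ZMod p, Q ≠ 0 ∧ ℓ = affineLine P Q := fun ℓ hℓ =>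
    hL ℓ (hAL' ℓ hℓ)
  have hplaneA : ∀ (w : Fin 3 → ZMod p) (b : ZMod p), w ≠ 0 →
      (A.filter (· ⊆ {x | w ⬝ᵥ x = b})).card ≤ p := by
    intro w b hw
    refine le_trans ?_ (hplane {x | w ⬝ᵥ x = b} ⟨w, b, hw, rfl⟩)
    rw [← Set.ncard_coe_finset]
    refine Set.ncard_le_ncard (fun ℓ hℓ => ?_) (Set.toFinite _)
    have := Finset.mem_filter.1 (Finset.mem_coe.1 hℓ)
    exact ⟨hAL' ℓ this.1, this.2⟩
  have hS : (⋃₀ L).ncard < (p / 100 + 1) ^ 3 := by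
    have h1 : p ≤ 100 * (p / 100 + 1) := by omega
    have h2 := Nat.pow_le_pow_left h1 3
    rw [mul_pow] at h2
    omega
  obtain ⟨F₀, hF₀, hF₀deg, hF₀S⟩ := exists_vanishing_polynomial (⋃₀ L) (Set.toFinite _) _ hS
  let 𝓕 : Set (MvPolynomial (Fin 3) (ZMod p)) :=
    {F | F ≠ 0 ∧ ∀ ℓ ∈ A, ∀ x ∈ ℓ, MvPolynomial.eval x F = 0}
  have hF₀mem : F₀ ∈ 𝓕 := ⟨hF₀, fun ℓ hℓ x hx => hF₀S x ⟨ℓ, hAL' ℓ hℓ, hx⟩⟩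
  obtain ⟨F, ⟨hF0, hF⟩, hmin⟩ : ∃ F ∈ 𝓕, ∀ G ∈ 𝓕, F.totalDegree ≤ G.totalDegree :=
    ⟨Function.argminOn MvPolynomial.totalDegree 𝓕 ⟨F₀, hF₀mem⟩, Function.argminOn_mem _ _ _,
      fun G hG => Function.argminOn_le _ _ hG⟩
  have hdeg : 100 * F.totalDegree ≤ 3 * p := by
    have := hmin F₀ hF₀mem
    omega
  have hpos : F.totalDegree ≠ 0 := by
    intro h0
    rw [MvPolynomial.totalDegree_eq_zero_iff_eq_C] at h0
    obtain ⟨ℓ, hℓ⟩ := hAne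
    obtain ⟨P, u, -, rfl⟩ := hA ℓ hℓ
    have := hF _ hℓ P ⟨0, by simp⟩
    rw [h0, MvPolynomial.eval_C] at this
    exact hF0 (by rw [h0, this, MvPolynomial.C_0])
  have hgrad := gradientAt_eq_zero_of_multiplicity (by omega) hA hplaneA hmult hdeg hF
  refine hpos (totalDegree_eq_zero_of_pderiv_eq_zero p (by omega) fun i => ?_)
  by_contra hi
  have h1 := hmin _ ⟨hi, fun ℓ hℓ x hx => congrFun (hgrad ℓ hℓ x hx) i⟩
  have h2 := totalDegree_pderiv_le i F
  omega
end
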